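/- arXiv:2305.18887 — 5 statements merged into one kernel-verified Lean document; each statement's English description precedes it below -/
import Mathlib

section
/- Let Φ be a finite set of encoders chosen independently of the training dataset, and let φ^s denote the encoder learned from s (with f^s = g^s∘φ^s the learned model, and all quantities Z, Z_y, c^y, 𝒵_{γ,y}, G₂, G₃ computed with φ^s and g^s). Then for every γ > 0 and δ > 0, with probability at least 1 − δ over the draw of s: if φ^s ∈ Φ, then Δ(s) ≤ G₃ · √( ( I(X;Z|Y)·ln 2 + G₂·ln 2 + ln(2|Φ||𝒴|/δ) ) / n ) + G₁(ln|Φ|) / √n, where G₁(q) = ℒ(f^s,s)·√(2γ|𝒴|)·√(q + ln(2|𝒴|/δ)) / n^{1/4} + γ·ℛ(f^s). -/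
open Real Finset
open scoped Classical

/-- Base-`b` Shannon entropy of a finitely supported distribution `p`
(the convention `0·log 0 = 0` is automatic since `Real.logb b 0 = 0`). -/
noncomputable def entB {α : Type*} [Fintype α] (b : ℝ) (p : α → ℝ) : ℝ :=
  -∑ a, p a * Real.logb b (p a)

/-- Hoeffding's lemma for a distribution `w` on a finite type. -/
theorem sum_mul_exp_sub_mean_le {E : Type*} [Fintype E] (w : E → ℝ) (hw0 : ∀ e, 0 ≤ w e)
    (hw1 : ∑ e, w e = 1) (a : E → ℝ) (c : ℝ) (ha : ∀ e e', |a e - a e'| ≤ c) (t : ℝ) :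
    ∑ e, w e * Real.exp (t * (a e - ∑ e', w e' * a e')) ≤ Real.exp (t ^ 2 * c ^ 2 / 8) := by
  let _ : MeasurableSpace E := ⊤
  have hne : Nonempty E := by
    by_contra h
    rw [not_nonempty_iff] at h
    simp at hw1
  let p : PMF E := PMF.ofFintype (fun e => ENNReal.ofReal (w e)) (by
    rw [← ENNReal.ofReal_sum_of_nonneg (fun e _ => hw0 e), hw1, ENNReal.ofReal_one])
  have hint (f : E → ℝ) : ∫ e, f e ∂p.toMeasure = ∑ e, w e * f e := by
    rw [PMF.integral_eq_sum]
    exact sum_congr rfl fun e _ => by simp [p, hw0 e]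
  obtain ⟨e₀, -, he₀⟩ := exists_min_image univ a univ_nonempty
  have hc : 0 ≤ c := (abs_nonneg _).trans (ha e₀ e₀)
  have h := (ProbabilityTheory.hasSubgaussianMGF_of_mem_Icc (μ := p.toMeasure) (X := a)
    (a := a e₀) (b := a e₀ + c) (measurable_from_top.aemeasurable)
    (.of_forall fun e => ⟨he₀ e (mem_univ _), by linarith [le_abs_self (a e - a e₀), ha e e₀]⟩)).mgf_le
      t
  rw [ProbabilityTheory.mgf, hint, hint] at h
  refine h.trans_eq ?_
  congr 1
  simp [abs_of_nonneg hc]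
  ring

theorem sum_prod_eq_one {ι : Type*} [Fintype ι] [DecidableEq ι] {E : ι → Type*} [∀ i, Fintype (E i)]
    (ν : ∀ i, E i → ℝ) (hν1 : ∀ i, ∑ e, ν i e = 1) :
    ∑ ξ : ∀ i, E i, ∏ i, ν i (ξ i) = 1 := by
  have := Finset.prod_univ_sum (fun i => (univ : Finset (E i))) ν
  rw [Fintype.piFinset_univ] at this
  rw [← this]
  simp [hν1]

theorem sum_pi_fin_succ {m : ℕ} {E : Fin (m + 1) → Type*} [∀ i, Fintype (E i)]
    (F : (∀ i, E i) → ℝ) :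
    ∑ ξ, F ξ = ∑ r : ∀ i : Fin m, E i.succ, ∑ e : E 0, F (Fin.cons e r) := by
  rw [← (Fin.consEquiv E).sum_comp, Fintype.sum_prod_type, sum_comm]
  rfl

/-- The moment generating function bound behind McDiarmid's inequality. -/
theorem sum_prod_mul_exp_le_of_bounded_differences (m : ℕ) (E : Fin m → Type*)
    [∀ i, Fintype (E i)] (ν : ∀ i, E i → ℝ) (hν0 : ∀ i e, 0 ≤ ν i e)
    (hν1 : ∀ i, ∑ e, ν i e = 1) (f : (∀ i, E i) → ℝ) (c : ℝ)
    (hf : ∀ (i : Fin m) (ξ ξ' : ∀ i, E i), (∀ j, j ≠ i → ξ j = ξ' j) → |f ξ - f ξ'| ≤ c)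
    (t : ℝ) :
    ∑ ξ, (∏ i, ν i (ξ i)) * Real.exp (t * (f ξ - ∑ ξ', (∏ i, ν i (ξ' i)) * f ξ')) ≤
      Real.exp (t ^ 2 * (m * c ^ 2) / 8) := by
  induction m with
  | zero => simp [Subsingleton.elim _ (default : ∀ i, E i)]
  | succ m ih =>
    set g : (∀ i : Fin m, E i.succ) → ℝ := fun r => ∑ e, ν 0 e * f (Fin.cons e r) with hg
    set W : (∀ i : Fin m, E i.succ) → ℝ := fun r => ∏ i, ν i.succ (r i) with hW
    have hW0 (r) : 0 ≤ W r := prod_nonneg fun i _ => hν0 _ _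
    have hmean : ∑ ξ, (∏ i, ν i (ξ i)) * f ξ = ∑ r, W r * g r := by
      rw [sum_pi_fin_succ]
      refine sum_congr rfl fun r _ => ?_
      rw [hg, mul_sum]
      refine sum_congr rfl fun e _ => ?_
      simp only [Fin.prod_univ_succ, Fin.cons_zero, Fin.cons_succ, hW]
      ring
    have hgdiff (i : Fin m) (r r' : ∀ i : Fin m, E i.succ) (h : ∀ j, j ≠ i → r j = r' j) :
        |g r - g r'| ≤ c := by
      calc |g r - g r'| = |∑ e, ν 0 e * (f (Fin.cons e r) - f (Fin.cons e r'))| := by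
            simp only [hg, mul_sub, sum_sub_distrib]
        _ ≤ ∑ e, ν 0 e * c := by
            refine (abs_sum_le_sum_abs _ _).trans (sum_le_sum fun e _ => ?_)
            rw [abs_mul, abs_of_nonneg (hν0 0 e)]
            refine mul_le_mul_of_nonneg_left (hf i.succ _ _ fun j hj => ?_) (hν0 0 e)
            cases j using Fin.cases with
            | zero => rfl
            | succ j => simpa using h j (fun hji => hj (by rw [hji]))
        _ = c := by rw [← sum_mul, hν1, one_mul]
    have hinner (r) : ∑ e, ν 0 e * Real.exp (t * (f (Fin.cons e r) - g r)) ≤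
        Real.exp (t ^ 2 * c ^ 2 / 8) :=
      sum_mul_exp_sub_mean_le (ν 0) (hν0 0) (hν1 0) (fun e => f (Fin.cons e r)) c
        (fun e e' => hf 0 _ _ fun j hj => by
          obtain ⟨k, rfl⟩ := Fin.exists_succ_eq.2 hj
          simp) t
    have hrec := ih (fun i => E i.succ) (fun i => ν i.succ) (fun i => hν0 _) (fun i => hν1 _)
      g hgdiff
    rw [hmean, sum_pi_fin_succ]
    calc _ = ∑ r, W r * Real.exp (t * (g r - ∑ r, W r * g r)) *
          ∑ e, ν 0 e * Real.exp (t * (f (Fin.cons e r) - g r)) := by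
          refine sum_congr rfl fun r _ => ?_
          rw [mul_sum]
          refine sum_congr rfl fun e _ => ?_
          have : t * (f (Fin.cons e r) - ∑ r, W r * g r) =
            t * (g r - ∑ r, W r * g r) + t * (f (Fin.cons e r) - g r) := by ring
          rw [this, Real.exp_add]
          simp only [Fin.prod_univ_succ, Fin.cons_zero, Fin.cons_succ, hW]
          ring
      _ ≤ ∑ r, W r * Real.exp (t * (g r - ∑ r, W r * g r)) * Real.exp (t ^ 2 * c ^ 2 / 8) :=
          sum_le_sum fun r _ => mul_le_mul_of_nonneg_left (hinner r)
            (mul_nonneg (hW0 r) (Real.exp_pos _).le)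
      _ ≤ Real.exp (t ^ 2 * (m * c ^ 2) / 8) * Real.exp (t ^ 2 * c ^ 2 / 8) := by
          rw [← sum_mul]
          exact mul_le_mul_of_nonneg_right hrec (Real.exp_pos _).le
      _ = _ := by
          rw [← Real.exp_add]
          congr 1
          push_cast
          ring

/-- McDiarmid's inequality at confidence level `1 / r`. -/
theorem sum_filter_deviation_le {m : ℕ} {E : Fin m → Type*}
    [∀ i, Fintype (E i)] (ν : ∀ i, E i → ℝ) (hν0 : ∀ i e, 0 ≤ ν i e)
    (hν1 : ∀ i, ∑ e, ν i e = 1) (f : (∀ i, E i) → ℝ) (c : ℝ)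
    (hf : ∀ (i : Fin m) (ξ ξ' : ∀ i, E i), (∀ j, j ≠ i → ξ j = ξ' j) → |f ξ - f ξ'| ≤ c)
    (r : ℝ) (hr : 0 < r) :
    ∑ ξ with c * Real.sqrt (m * Real.log r / 2) < f ξ - ∑ ξ', (∏ i, ν i (ξ' i)) * f ξ',
      ∏ i, ν i (ξ i) ≤ 1 / r := by
  set M := ∑ ξ', (∏ i, ν i (ξ' i)) * f ξ' with hM
  set W : (∀ i, E i) → ℝ := fun ξ => ∏ i, ν i (ξ i) with hW
  have hW0 (ξ) : 0 ≤ W ξ := prod_nonneg fun i _ => hν0 _ _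
  have hmgf (t : ℝ) := sum_prod_mul_exp_le_of_bounded_differences m E ν hν0 hν1 f c hf t
  have hle1 (p : (∀ i, E i) → Prop) : ∑ ξ with p ξ, W ξ ≤ 1 :=
    (sum_le_sum_of_subset_of_nonneg (filter_subset _ _) fun ξ _ _ => hW0 ξ).trans_eq
      (sum_prod_eq_one ν hν1)
  rcases le_or_gt r 1 with hr1 | hr1
  · exact (hle1 _).trans ((one_le_div hr).2 hr1)
  have hlog : 0 < Real.log r := Real.log_pos hr1
  by_cases hmc : (m : ℝ) * c ^ 2 = 0
  · have hz : c * Real.sqrt (m * Real.log r / 2) = 0 := by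
      rcases mul_eq_zero.1 hmc with h | h
      · simp [h]
      · simp [pow_eq_zero_iff two_ne_zero |>.1 h]
    have hsum : ∑ ξ, W ξ * (Real.exp (f ξ - M) - 1 - (f ξ - M)) ≤ 0 := by
      have h1 := hmgf 1
      simp only [hmc, mul_zero, zero_div, Real.exp_zero, one_mul, ← hM] at h1
      have h2 : ∑ ξ, W ξ = 1 := sum_prod_eq_one ν hν1
      have h3 : ∑ ξ, W ξ * (f ξ - M) = 0 := by
        have h4 : ∑ ξ, W ξ * f ξ = M := rfl
        simp only [mul_sub, sum_sub_distrib, ← sum_mul, h2, h4, one_mul, sub_self]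
      simp only [mul_sub _ (_ - _), sum_sub_distrib, h3, mul_sub _ _ (1 : ℝ), mul_one, h2]
      linarith
    have hterm (ξ) : 0 ≤ W ξ * (Real.exp (f ξ - M) - 1 - (f ξ - M)) :=
      mul_nonneg (hW0 ξ) (by linarith [Real.add_one_le_exp (f ξ - M)])
    have hzero := (sum_eq_zero_iff_of_nonneg fun ξ _ => hterm ξ).1
      (le_antisymm hsum (sum_nonneg fun ξ _ => hterm ξ))
    rw [sum_eq_zero]
    · positivity
    · intro ξ hξ
      rw [mem_filter, hz] at hξ
      exact (mul_eq_zero.1 (hzero ξ (mem_univ _))).resolve_right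
        (by linarith [Real.add_one_lt_exp hξ.2.ne'])
  · have hm : 0 < m := Nat.pos_of_ne_zero fun h => hmc (by simp [h])
    have hne : Nonempty (∀ i, E i) := by
      by_contra h
      rw [not_nonempty_iff] at h
      simpa using sum_prod_eq_one ν hν1
    have hc : 0 ≤ c := (abs_nonneg _).trans
      (hf ⟨0, hm⟩ hne.some hne.some fun _ _ => rfl)
    set ε := c * Real.sqrt (m * Real.log r / 2) with hε
    have hε0 : 0 ≤ ε := by positivity
    have hε2 : ε ^ 2 = m * c ^ 2 * Real.log r / 2 := by
      rw [hε, mul_pow, Real.sq_sqrt (by positivity)]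
      ring
    set v := (m : ℝ) * c ^ 2 with hv
    set t := 4 * ε / v with ht
    have ht0 : 0 ≤ t := by positivity
    calc ∑ ξ with ε < f ξ - M, W ξ
        ≤ ∑ ξ with ε < f ξ - M, W ξ * Real.exp (t * (f ξ - M)) * Real.exp (-(t * ε)) := by
          refine sum_le_sum fun ξ hξ => ?_
          rw [mem_filter] at hξ
          rw [mul_assoc, ← Real.exp_add]
          refine le_mul_of_one_le_right (hW0 ξ) (Real.one_le_exp ?_)
          nlinarith [hξ.2]
      _ ≤ ∑ ξ, W ξ * Real.exp (t * (f ξ - M)) * Real.exp (-(t * ε)) :=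
          sum_le_sum_of_subset_of_nonneg (filter_subset _ _) fun ξ _ _ =>
            mul_nonneg (mul_nonneg (hW0 ξ) (Real.exp_pos _).le) (Real.exp_pos _).le
      _ ≤ Real.exp (t ^ 2 * v / 8) * Real.exp (-(t * ε)) := by
          rw [← sum_mul]
          exact mul_le_mul_of_nonneg_right (hmgf t) (Real.exp_pos _).le
      _ = 1 / r := by
          rw [← Real.exp_add, one_div, ← Real.exp_log (inv_pos.2 hr), Real.log_inv]
          congr 1
          have : t ^ 2 * v / 8 + -(t * ε) = -(2 * ε ^ 2 / v) := by
            rw [ht]; field_simp; ring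
          rw [this, hε2]
          field_simp

theorem exp_neg_le_quadratic {u : ℝ} (hu : 0 ≤ u) : Real.exp (-u) ≤ 1 - u + u ^ 2 / 2 := by
  have h := Real.quadratic_le_exp_of_nonneg hu
  rw [Real.exp_neg, inv_le_iff_one_le_mul₀ (Real.exp_pos u)]
  nlinarith [sq_nonneg (u ^ 2), sq_nonneg (u - 1)]

/-- Multiplicative Chernoff bound for the lower tail of the empirical mean of an i.i.d. sample
of `[0, 1]`-valued variables. -/
theorem sum_filter_empirical_mean_lt_le {α : Type*} [Fintype α] (P : α → ℝ) (hP0 : ∀ a, 0 ≤ P a)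
    (hP1 : ∑ a, P a = 1) (b : α → ℝ) (hb0 : ∀ a, 0 ≤ b a) (hb1 : ∀ a, b a ≤ 1)
    {n : ℕ} (hn : 0 < n) (t : ℝ) (ht : 0 ≤ t) :
    ∑ s : Fin n → α with Real.sqrt (2 * (∑ a, P a * b a) * t / n) <
        ∑ a, P a * b a - (1 / n) * ∑ i, b (s i),
      ∏ i, P (s i) ≤ Real.exp (-t) := by
  set p := ∑ a, P a * b a with hp
  have hp0 : 0 ≤ p := sum_nonneg fun a _ => mul_nonneg (hP0 a) (hb0 a)
  have hn' : (0 : ℝ) < n := Nat.cast_pos.2 hn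
  have hW0 (s : Fin n → α) : 0 ≤ ∏ i, P (s i) := prod_nonneg fun i _ => hP0 _
  rcases hp0.eq_or_lt with hpz | hpz
  · rw [filter_false_of_mem]
    · simpa using (Real.exp_pos _).le
    · intro s _
      rw [← hpz]
      have : 0 ≤ (1 / (n : ℝ)) * ∑ i, b (s i) :=
        mul_nonneg (by positivity) (sum_nonneg fun i _ => hb0 _)
      simpa using this
  set d := Real.sqrt (2 * p * t / n) with hd
  have hd2 : d ^ 2 = 2 * p * t / n := Real.sq_sqrt (by positivity)
  set lam := d / p with hlam
  have hlam0 : 0 ≤ lam := by positivity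
  have hfac : ∑ a, P a * Real.exp (-(lam * b a)) ≤ Real.exp (-(p * (lam - lam ^ 2 / 2))) := by
    calc ∑ a, P a * Real.exp (-(lam * b a))
        ≤ ∑ a, (P a - P a * b a * (lam - lam ^ 2 / 2)) := by
          refine sum_le_sum fun a _ => ?_
          have h1 := exp_neg_le_quadratic (mul_nonneg hlam0 (hb0 a))
          have h2 : Real.exp (-(lam * b a)) ≤ 1 - b a * (lam - lam ^ 2 / 2) := by
            nlinarith [mul_nonneg (sq_nonneg lam) (mul_nonneg (hb0 a) (sub_nonneg.2 (hb1 a)))]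
          nlinarith [mul_le_mul_of_nonneg_left h2 (hP0 a)]
      _ = -(p * (lam - lam ^ 2 / 2)) + 1 := by
          rw [sum_sub_distrib, hP1, ← sum_mul]
          ring
      _ ≤ _ := Real.add_one_le_exp _
  calc ∑ s : Fin n → α with d < p - (1 / n) * ∑ i, b (s i), ∏ i, P (s i)
      ≤ ∑ s : Fin n → α with d < p - (1 / n) * ∑ i, b (s i),
          (∏ i, P (s i) * Real.exp (-(lam * b (s i)))) * Real.exp (n * (lam * (p - d))) := by
        refine sum_le_sum fun s hs => ?_
        rw [mem_filter] at hs
        rw [prod_mul_distrib, ← Real.exp_sum, mul_assoc, ← Real.exp_add]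
        refine le_mul_of_one_le_right (hW0 s) (Real.one_le_exp ?_)
        rw [sum_neg_distrib, ← mul_sum]
        have h1 : ∑ i, b (s i) ≤ n * (p - d) := by
          have h2 := mul_le_mul_of_nonneg_left hs.2.le hn'.le
          have h3 : (n : ℝ) * (1 / n * ∑ i, b (s i)) = ∑ i, b (s i) := by field_simp
          rw [mul_sub, h3] at h2
          linarith
        nlinarith [mul_le_mul_of_nonneg_left h1 hlam0]
    _ ≤ ∑ s : Fin n → α,
          (∏ i, P (s i) * Real.exp (-(lam * b (s i)))) * Real.exp (n * (lam * (p - d))) :=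
        sum_le_sum_of_subset_of_nonneg (filter_subset _ _) fun s _ _ =>
          mul_nonneg (prod_nonneg fun i _ => mul_nonneg (hP0 _) (Real.exp_pos _).le)
            (Real.exp_pos _).le
    _ = (∑ a, P a * Real.exp (-(lam * b a))) ^ n * Real.exp (n * (lam * (p - d))) := by
        rw [← sum_mul, Fintype.sum_pow]
    _ ≤ Real.exp (-(p * (lam - lam ^ 2 / 2))) ^ n * Real.exp (n * (lam * (p - d))) := by
        refine mul_le_mul_of_nonneg_right (pow_le_pow_left₀ ?_ hfac n) (Real.exp_pos _).le
        exact sum_nonneg fun a _ => mul_nonneg (hP0 a) (Real.exp_pos _).le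
    _ = Real.exp (-t) := by
        rw [← Real.exp_nat_mul, ← Real.exp_add]
        congr 1
        have : n * -(p * (lam - lam ^ 2 / 2)) + n * (lam * (p - d)) = -(n * d ^ 2 / (2 * p)) := by
          rw [hlam]; field_simp; ring
        rw [this, hd2]
        field_simp

/-- Union bound: an event containing the complement of all bad events is likely. -/
theorem one_sub_sum_le_sum_of_forall_not_imp_mem {S K : Type*} [Fintype S]
    (w : S → ℝ) (hw0 : ∀ s, 0 ≤ w s) (hw1 : ∑ s, w s = 1) (T : Finset K) (bad : K → S → Prop) (good : Finset S)
    (h : ∀ s, (∀ k ∈ T, ¬ bad k s) → s ∈ good) :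
    1 - ∑ k ∈ T, ∑ s with bad k s, w s ≤ ∑ s ∈ good, w s := by
  rw [sub_le_iff_le_add, ← hw1]
  simp only [sum_filter]
  rw [sum_comm, ← univ_inter good, ← sum_ite_mem, ← sum_add_distrib]
  refine sum_le_sum fun s _ => ?_
  have hterm (k) : 0 ≤ if bad k s then w s else 0 := by split_ifs <;> simp [hw0]
  by_cases hs : s ∈ good
  · rw [if_pos hs]
    linarith [sum_nonneg fun k (_ : k ∈ T) => hterm k]
  · obtain ⟨k, hk, hbad⟩ : ∃ k ∈ T, bad k s := by
      by_contra! hno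
      exact hs (h s hno)
    have := single_le_sum (fun k (_ : k ∈ T) => hterm k) hk
    rw [if_pos hbad] at this
    rw [if_neg hs]
    linarith

theorem sum_mul_sum_fiber {α β : Type*} [Fintype α] [Fintype β] [DecidableEq β] (g : α → β)
    (w : α → ℝ) (h : β → ℝ) :
    ∑ b, h b * ∑ a ∈ univ.filter (fun a => g a = b), w a = ∑ a, w a * h (g a) := by
  simp only [sum_filter, mul_sum]
  rw [sum_comm]
  refine sum_congr rfl fun a _ => ?_
  simp [mul_comm]

theorem entB_nonneg {α : Type*} [Fintype α] (p : α → ℝ) (hp0 : ∀ a, 0 ≤ p a)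
    (hp1 : ∑ a, p a = 1) : 0 ≤ entB 2 p := by
  rw [entB, neg_nonneg]
  refine sum_nonpos fun a _ => mul_nonpos_of_nonneg_of_nonpos (hp0 a) ?_
  refine Real.logb_nonpos (by norm_num) (hp0 a) ?_
  rw [← hp1]
  exact single_le_sum (fun a _ => hp0 a) (mem_univ a)

theorem entB_graph {α β : Type*} [Fintype α] [Fintype β] [DecidableEq β] (b : ℝ) (p : α → ℝ)
    (φ : α → β) : entB b (fun xz : α × β => if φ xz.1 = xz.2 then p xz.1 else 0) = entB b p := by
  simp only [entB, Fintype.sum_prod_type]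
  congr 1
  refine sum_congr rfl fun a _ => ?_
  rw [sum_eq_single (φ a)]
  · simp
  · intro z _ hz
    simp [hz.symm]
  · simp

/-- The mass outside the typical set of the image of a product distribution. -/
theorem sum_atypical_le {m : ℕ} {E : Fin m → Type*} [∀ i, Fintype (E i)] {𝒵 : Type*} [Fintype 𝒵]
    [DecidableEq 𝒵] (ν : ∀ i, E i → ℝ) (hν0 : ∀ i e, 0 ≤ ν i e) (hν1 : ∀ i, ∑ e, ν i e = 1)
    (g : (∀ i, E i) → 𝒵) (q : 𝒵 → ℝ)
    (hq : ∀ z, q z = ∑ ξ ∈ univ.filter (fun ξ => g ξ = z), ∏ i, ν i (ξ i))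
    (hpos : ∀ ξ, 0 < q (g ξ)) (c : ℝ)
    (hsens : ∀ (i : Fin m) (ξ ξ' : ∀ i, E i), (∀ j, j ≠ i → ξ j = ξ' j) →
      |Real.logb 2 (q (g ξ)) - Real.logb 2 (q (g ξ'))| ≤ c)
    (r : ℝ) (hr : 0 < r) (T : Finset 𝒵)
    (hT : ∀ z, z ∈ T ↔ 0 < q z ∧
      -Real.logb 2 (q z) - entB 2 q ≤ c * Real.sqrt (m * Real.log r / 2)) :
    ∑ z ∈ Tᶜ, q z ≤ 1 / r := by
  have hmean : ∑ ξ, (∏ i, ν i (ξ i)) * -Real.logb 2 (q (g ξ)) = entB 2 q := by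
    rw [← sum_mul_sum_fiber g _ (fun z => -Real.logb 2 (q z)), entB, ← sum_neg_distrib]
    refine sum_congr rfl fun z _ => ?_
    rw [← hq]
    ring
  have htail := sum_filter_deviation_le ν hν0 hν1 (fun ξ => -Real.logb 2 (q (g ξ))) c
    (fun i ξ ξ' h => by
      rw [neg_sub_neg, abs_sub_comm]
      exact hsens i ξ ξ' h) r hr
  rw [hmean] at htail
  refine le_trans (le_of_eq ?_) htail
  calc ∑ z ∈ Tᶜ, q z = ∑ z, (if z ∈ T then 0 else 1) * q z := by
        symm
        rw [← sum_add_sum_compl T, sum_eq_zero (s := T) fun z hz => by rw [if_pos hz, zero_mul],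
          zero_add]
        exact sum_congr rfl fun z hz => by rw [if_neg (mem_compl.1 hz), one_mul]
    _ = ∑ ξ, (∏ i, ν i (ξ i)) * (if g ξ ∈ T then 0 else 1) := by
        rw [← sum_mul_sum_fiber g _ (fun z => if z ∈ T then (0 : ℝ) else 1)]
        exact sum_congr rfl fun z _ => by rw [hq]
    _ = _ := by
        rw [sum_filter]
        refine sum_congr rfl fun ξ _ => ?_
        by_cases h : g ξ ∈ T
        · rw [if_pos h, if_neg (not_lt.2 ((hT _).1 h).2), mul_zero]
        · rw [if_neg h, if_pos, mul_one]
          by_contra h'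
          exact h ((hT _).2 ⟨hpos ξ, not_lt.1 h'⟩)

/-- Concentration of each typical cell and small atypical mass control the weighted gap. -/
theorem sum_gap_le {𝒴 𝒵 : Type*} [Fintype 𝒴] [Nonempty 𝒴] [Fintype 𝒵] [DecidableEq 𝒵]
    (pY : 𝒴 → ℝ) (hpY0 : ∀ y, 0 ≤ pY y) (hpY1 : ∑ y, pY y = 1) (q phat loss : 𝒴 → 𝒵 → ℝ)
    (hq0 : ∀ y z, 0 ≤ q y z) (hphat0 : ∀ y z, 0 ≤ phat y z) (hloss0 : ∀ y z, 0 ≤ loss y z)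
    (T : 𝒴 → Finset 𝒵) (K : 𝒴 → ℝ) (hK0 : ∀ y, 0 ≤ K y) (R β G n : ℝ) (hn : 0 < n) (hR0 : 0 ≤ R)
    (hR : ∀ y z, 0 < q y z → loss y z ≤ R) (hβ : ∀ y, ∑ z ∈ (T y)ᶜ, q y z ≤ β)
    (hdev : ∀ y, ∀ z ∈ T y, pY y * q y z - phat y z ≤ Real.sqrt (2 * (pY y * q y z) * K y / n))
    (hG : ∀ y, ∑ z ∈ T y, loss y z * Real.sqrt (2 * (Fintype.card 𝒴) * q y z) ≤ G) :
    ∑ y, ∑ z, loss y z * (pY y * q y z - phat y z) ≤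
      G * Real.sqrt ((∑ y, pY y * K y) / n) + R * β := by
  have hN : (0 : ℝ) < Fintype.card 𝒴 := Nat.cast_pos.2 Fintype.card_pos
  have hG0 : 0 ≤ G := (sum_nonneg fun z _ => mul_nonneg (hloss0 _ z) (Real.sqrt_nonneg _)).trans
    (hG (Classical.arbitrary 𝒴))
  set N := (Fintype.card 𝒴 : ℝ) with hNdef
  set a : 𝒴 → ℝ := fun y => pY y * K y / (n * N) with ha
  have ha0 (y) : 0 ≤ a y := div_nonneg (mul_nonneg (hpY0 y) (hK0 y)) (by positivity)
  have htyp (y) : ∑ z ∈ T y, loss y z * (pY y * q y z - phat y z) ≤ G * Real.sqrt (a y) := by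
    refine le_trans ?_ (mul_le_mul_of_nonneg_right (hG y) (Real.sqrt_nonneg _))
    rw [sum_mul]
    refine sum_le_sum fun z hz => ?_
    rw [mul_assoc, ← Real.sqrt_mul (mul_nonneg (by positivity) (hq0 y z))]
    refine mul_le_mul_of_nonneg_left ((hdev y z hz).trans_eq ?_) (hloss0 y z)
    congr 1
    simp only [ha]
    field_simp
  have hatyp (y) : ∑ z ∈ (T y)ᶜ, loss y z * (pY y * q y z - phat y z) ≤ pY y * (R * β) := by
    calc _ ≤ ∑ z ∈ (T y)ᶜ, pY y * R * q y z := by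
          refine sum_le_sum fun z _ => ?_
          rcases (hq0 y z).eq_or_lt with h | h
          · rw [← h]
            nlinarith [mul_nonneg (hloss0 y z) (hphat0 y z)]
          · have h1 := mul_le_mul_of_nonneg_right (hR y z h) (mul_nonneg (hpY0 y) h.le)
            nlinarith [mul_nonneg (hloss0 y z) (hphat0 y z)]
      _ ≤ pY y * R * β := by
          rw [← mul_sum]
          exact mul_le_mul_of_nonneg_left (hβ y) (mul_nonneg (hpY0 y) hR0)
      _ = _ := by ring
  have hsqrt : ∑ y, Real.sqrt (a y) ≤ Real.sqrt ((∑ y, pY y * K y) / n) := by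
    refine Real.le_sqrt_of_sq_le ((sq_sum_le_card_mul_sum_sq).trans_eq ?_)
    simp only [Real.sq_sqrt (ha0 _), card_univ, ← hNdef]
    simp only [ha, ← sum_div]
    field_simp
  calc ∑ y, ∑ z, loss y z * (pY y * q y z - phat y z)
      ≤ ∑ y, (G * Real.sqrt (a y) + pY y * (R * β)) := by
        refine sum_le_sum fun y _ => ?_
        rw [← sum_add_sum_compl (T y)]
        exact add_le_add (htyp y) (hatyp y)
    _ ≤ _ := by
        rw [sum_add_distrib, ← mul_sum, ← sum_mul, hpY1, one_mul]
        exact add_le_add_left (mul_le_mul_of_nonneg_left hsqrt hG0) _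

/-- Lemma 3, encoder from a fixed finite family `Φ`: with probability at
least `1 − δ` over the i.i.d. draw of `s`: if the learned encoder `φˢ = A(s)` lies in `Φ`,
then `Δ(s) ≤ G₃·√((I(X;Zˢ|Y)·ln2 + G₂·ln2 + ln(2|Φ||𝒴|/δ))/n) + G₁(ln|Φ|)/√n`,
where `G₁(q) = ℒ(fˢ,s)·√(2γ|𝒴|)·√(q + ln(2|𝒴|/δ))/n^{1/4} + γ·ℛ(fˢ)` and all
quantities are computed with the learned encoder `φˢ` and decoder `gˢ`. -/
theorem ib_encoder_in_fixed_family_generalization_bound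
    {𝒳 𝒴 𝒵 : Type*} [Fintype 𝒳] [Fintype 𝒴] [Fintype 𝒵]
    [Nonempty 𝒳] [Nonempty 𝒴] [DecidableEq 𝒳] [DecidableEq 𝒵]
    -- data distribution P over 𝒳 × 𝒴 and its 𝒴-marginal
    (P : 𝒳 × 𝒴 → ℝ) (hP0 : ∀ a, 0 ≤ P a) (hP1 : ∑ a, P a = 1)
    (pY : 𝒴 → ℝ) (hpY : ∀ y, pY y = ∑ x, P (x, y))
    -- generative structure: given Y = y, X = χ(y, Ξ_y) with Ξ_y having m mutually
    -- independent finite-valued coordinates, coordinate i distributed as ν y i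
    (m : ℕ) (E : Fin m → Type*) [∀ i, Fintype (E i)]
    (ν : 𝒴 → ∀ i, E i → ℝ) (hν0 : ∀ y i e, 0 ≤ ν y i e) (hν1 : ∀ y i, ∑ e, ν y i e = 1)
    (χ : 𝒴 → (∀ i, E i) → 𝒳)
    (PΞ : 𝒴 → (∀ i, E i) → ℝ) (hPΞ : ∀ y ξ, PΞ y ξ = ∏ i, ν y i (ξ i))
    (pXy : 𝒴 → 𝒳 → ℝ)
    (hpXy : ∀ y x, pXy y x = ∑ ξ ∈ univ.filter (fun ξ => χ y ξ = x), PΞ y ξ)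
    (hgen : ∀ x y, P (x, y) = pY y * pXy y x)
    -- sample size and parameters
    (n : ℕ) (hn : 0 < n) (γ δ : ℝ) (hγ : 0 < γ) (hδ : 0 < δ)
    -- learned model: encoder φˢ = A(s) and decoder gˢ = B(s); fixed finite family Φ
    {my : ℕ} (A : (Fin n → 𝒳 × 𝒴) → 𝒳 → 𝒵) (B : (Fin n → 𝒳 × 𝒴) → 𝒵 → Fin my → ℝ)
    (Φ : Finset (𝒳 → 𝒵)) (hΦ : Φ.Nonempty)
    (ℓ : (Fin my → ℝ) → 𝒴 → ℝ) (hℓ0 : ∀ q y, 0 ≤ ℓ q y)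
    -- conditional law of Zˢ = φˢ(X) given Y = y; positivity on attainable points
    (pZy : (Fin n → 𝒳 × 𝒴) → 𝒴 → 𝒵 → ℝ)
    (hpZy : ∀ s y z, pZy s y z = ∑ ξ ∈ univ.filter (fun ξ => A s (χ y ξ) = z), PΞ y ξ)
    (hpos : ∀ s y ξ, 0 < pZy s y (A s (χ y ξ)))
    (HZy : (Fin n → 𝒳 × 𝒴) → 𝒴 → ℝ) (hHZy : ∀ s y, HZy s y = entB 2 (pZy s y))
    -- sensitivity of the learned encoder w.r.t. each nuisance coordinate
    (c : (Fin n → 𝒳 × 𝒴) → 𝒴 → ℝ)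
    (hsens : ∀ s y (i : Fin m) (ξ ξ' : ∀ i, E i), (∀ j, j ≠ i → ξ j = ξ' j) →
      |Real.logb 2 (pZy s y (A s (χ y ξ))) - Real.logb 2 (pZy s y (A s (χ y ξ')))| ≤ c s y)
    -- typical sets 𝒵_{γ,y} and the constants of the bound
    (εy : (Fin n → 𝒳 × 𝒴) → 𝒴 → ℝ)
    (hεy : ∀ s y, εy s y = c s y * Real.sqrt (m * Real.log (Real.sqrt n / γ) / 2))
    (Ztyp : (Fin n → 𝒳 × 𝒴) → 𝒴 → Finset 𝒵)
    (hZtyp : ∀ s y, Ztyp s y =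
      univ.filter (fun z => 0 < pZy s y z ∧ -Real.logb 2 (pZy s y z) - HZy s y ≤ εy s y))
    (G₂ : (Fin n → 𝒳 × 𝒴) → ℝ)
    (hG₂ : ∀ s, G₂ s = (∑ y, pY y * c s y) * Real.sqrt (m * Real.log (Real.sqrt n / γ) / 2))
    (G₃ : (Fin n → 𝒳 × 𝒴) → ℝ)
    (hG₃ : ∀ s, G₃ s = univ.sup' univ_nonempty (fun y =>
      ∑ z ∈ Ztyp s y, ℓ (B s z) y * Real.sqrt (2 * (Fintype.card 𝒴) * pZy s y z)))
    -- conditional mutual information I(X;Zˢ|Y), with base-2 logarithms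
    (IXZY : (Fin n → 𝒳 × 𝒴) → ℝ)
    (hIXZY : ∀ s, IXZY s = ∑ y, pY y *
      (entB 2 (pXy y) + entB 2 (pZy s y)
        - entB 2 (fun xz : 𝒳 × 𝒵 => if A s xz.1 = xz.2 then pXy y xz.1 else 0)))
    -- supremum loss ℛ(fˢ), empirical maximum loss ℒ(fˢ,s), gap Δ(s), and G₁
    (ℛ : (Fin n → 𝒳 × 𝒴) → ℝ)
    (hℛ : ∀ s, ℛ s = univ.sup' univ_nonempty (fun a : 𝒳 × 𝒴 => ℓ (B s (A s a.1)) a.2))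
    (Pn : (Fin n → 𝒳 × 𝒴) → ℝ) (hPn : ∀ s, Pn s = ∏ i, P (s i))
    (Δ L : (Fin n → 𝒳 × 𝒴) → ℝ) (G₁ : (Fin n → 𝒳 × 𝒴) → ℝ → ℝ)
    (hΔ : ∀ s, Δ s = (∑ a : 𝒳 × 𝒴, P a * ℓ (B s (A s a.1)) a.2)
      - (1 / n) * ∑ i, ℓ (B s (A s (s i).1)) (s i).2)
    (hL : ∀ s, L s = ⨆ i : Fin n, ℓ (B s (A s (s i).1)) (s i).2)
    (hG₁ : ∀ s q, G₁ s q = L s * Real.sqrt (2 * γ * (Fintype.card 𝒴))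
        * Real.sqrt (q + Real.log (2 * (Fintype.card 𝒴) / δ)) / (n : ℝ) ^ ((1 : ℝ) / 4)
      + γ * ℛ s) :
    1 - δ ≤ ∑ s ∈ univ.filter (fun s : Fin n → 𝒳 × 𝒴 =>
      A s ∈ Φ →
        Δ s ≤ G₃ s * Real.sqrt ((IXZY s * Real.log 2 + G₂ s * Real.log 2
            + Real.log (2 * Φ.card * (Fintype.card 𝒴) / δ)) / n)
          + G₁ s (Real.log Φ.card) / Real.sqrt n), Pn s := by
  have hW0 y ξ : 0 ≤ PΞ y ξ := hPΞ y ξ ▸ prod_nonneg fun i _ => hν0 _ _ _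
  have hW1 y : ∑ ξ, PΞ y ξ = 1 := by
    simp only [hPΞ]
    exact sum_prod_eq_one _ (hν1 y)
  have hpY0 y : 0 ≤ pY y := hpY y ▸ sum_nonneg fun x _ => hP0 _
  have hpY1 : ∑ y, pY y = 1 := by
    simp only [hpY]
    rw [← hP1, Fintype.sum_prod_type, sum_comm]
  have hPn0 s : 0 ≤ Pn s := hPn s ▸ prod_nonneg fun i _ => hP0 _
  have hPn1 : ∑ s, Pn s = 1 := by
    simp only [hPn]
    exact sum_prod_eq_one (fun _ => P) (fun _ => hP1)
  rcases le_or_gt 1 δ with hδ1 | hδ1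
  · exact (sub_nonpos.2 hδ1).trans (sum_nonneg fun s _ => hPn0 s)
  have hn' : (0 : ℝ) < n := Nat.cast_pos.2 hn
  have hN : (1 : ℝ) ≤ Fintype.card 𝒴 := Nat.one_le_cast.2 Fintype.card_pos
  have hM : (1 : ℝ) ≤ Φ.card := Nat.one_le_cast.2 hΦ.card_pos
  obtain ⟨D, hD⟩ : ∃ D : ℝ, 2 * Φ.card * Fintype.card 𝒴 / δ = D := ⟨_, rfl⟩
  have hD1 : 1 ≤ D := by
    rw [← hD, one_le_div hδ]
    nlinarith
  have hD0 : 0 < D := one_pos.trans_le hD1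
  rw [hD]
  let q : (𝒳 → 𝒵) → 𝒴 → 𝒵 → ℝ :=
    fun φ y z => ∑ ξ ∈ univ.filter (fun ξ => φ (χ y ξ) = z), PΞ y ξ
  have hq0 φ y z : 0 ≤ q φ y z := sum_nonneg fun ξ _ => hW0 y ξ
  have hq1 φ y : ∑ z, q φ y z = 1 := by
    simpa [hW1] using sum_mul_sum_fiber (fun ξ => φ (χ y ξ)) (PΞ y) (fun _ => (1 : ℝ))
  have hq_le φ y z : q φ y z ≤ 1 := by
    rw [← hq1 φ y]
    exact single_le_sum (fun z _ => hq0 φ y z) (mem_univ z)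
  have hmean (φ : 𝒳 → 𝒵) (F : 𝒵 → 𝒴 → ℝ) :
      ∑ a : 𝒳 × 𝒴, P a * F (φ a.1) a.2 = ∑ y, ∑ z, F z y * (pY y * q φ y z) := by
    rw [Fintype.sum_prod_type, sum_comm]
    refine sum_congr rfl fun y _ => ?_
    calc ∑ x, P (x, y) * F (φ x) y = pY y * ∑ x, F (φ x) y * pXy y x := by
          rw [mul_sum]
          exact sum_congr rfl fun x _ => by rw [hgen]; ring
      _ = pY y * ∑ z, F z y * q φ y z := by
          simp only [hpXy, q]
          rw [sum_mul_sum_fiber (χ y) (PΞ y) (fun x => F (φ x) y),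
            sum_mul_sum_fiber (fun ξ => φ (χ y ξ)) (PΞ y) (fun z => F z y)]
      _ = _ := by
          rw [mul_sum]
          exact sum_congr rfl fun z _ => by ring
  let b : 𝒴 → 𝒵 → 𝒵 → 𝒴 → ℝ := fun y z z' y' => if z' = z ∧ y' = y then 1 else 0
  have hb0 y z z' y' : 0 ≤ b y z z' y' := by
    simp only [b]; split_ifs <;> norm_num
  have hb1 y z z' y' : b y z z' y' ≤ 1 := by
    simp only [b]; split_ifs <;> norm_num
  have hmeanb φ y z : ∑ a : 𝒳 × 𝒴, P a * b y z (φ a.1) a.2 = pY y * q φ y z := by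
    rw [hmean φ (b y z), sum_eq_single y, sum_eq_single z]
    · simp [b]
    · intro z' _ hz
      simp [b, hz]
    · simp
    · intro y' _ hy
      simp [b, hy]
    · simp
  let phat : (𝒳 → 𝒵) → (Fin n → 𝒳 × 𝒴) → 𝒴 → 𝒵 → ℝ :=
    fun φ s y z => (1 / n) * ∑ i, b y z (φ (s i).1) (s i).2
  have hsumb (F : 𝒴 → 𝒵 → ℝ) z' y' : ∑ y, ∑ z, F y z * b y z z' y' = F y' z' := by
    rw [sum_eq_single y', sum_eq_single z']
    · simp [b]
    · intro z _ hz
      simp [b, hz.symm]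
    · simp
    · intro y _ hy
      simp [b, hy.symm]
    · simp
  obtain ⟨bad, hbad_iff⟩ : ∃ bad : (𝒳 → 𝒵) × 𝒴 × 𝒵 → (Fin n → 𝒳 × 𝒴) → Prop, ∀ k s, bad k s ↔
    0 < q k.1 k.2.1 k.2.2 ∧
      Real.sqrt (2 * (pY k.2.1 * q k.1 k.2.1 k.2.2) * Real.log (D / q k.1 k.2.1 k.2.2) / n) <
        pY k.2.1 * q k.1 k.2.1 k.2.2 - phat k.1 s k.2.1 k.2.2 :=
    ⟨_, fun _ _ => Iff.rfl⟩
  have hbad k : ∑ s with bad k s, Pn s ≤ q k.1 k.2.1 k.2.2 / D := by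
    obtain ⟨φ, y, z⟩ := k
    rcases (hq0 φ y z).eq_or_lt with h | h
    · rw [filter_false_of_mem fun s _ hs => (h ▸ ((hbad_iff _ _).1 hs).1).false, sum_empty]
      exact div_nonneg (hq0 _ _ _) hD0.le
    · have hDq : 0 < D / q φ y z := div_pos hD0 h
      have := sum_filter_empirical_mean_lt_le P hP0 hP1 (fun a => b y z (φ a.1) a.2)
        (fun a => hb0 _ _ _ _) (fun a => hb1 _ _ _ _) hn (Real.log (D / q φ y z))
        (Real.log_nonneg ((one_le_div h).2 ((hq_le φ y z).trans hD1)))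
      rw [hmeanb, Real.exp_neg, Real.exp_log hDq, inv_div] at this
      simp only [hPn]
      refine le_trans (le_of_eq (sum_congr ?_ fun _ _ => rfl)) this
      ext s
      simp [hbad_iff, h, phat]
  have hbadsum : ∑ k ∈ Φ ×ˢ (univ : Finset (𝒴 × 𝒵)), ∑ s with bad k s, Pn s ≤ δ := by
    calc _ ≤ ∑ k ∈ Φ ×ˢ (univ : Finset (𝒴 × 𝒵)), q k.1 k.2.1 k.2.2 / D :=
          sum_le_sum fun k _ => hbad k
      _ = δ / 2 := by
          rw [sum_product]
          simp only [Fintype.sum_prod_type, ← sum_div, hq1, sum_const, card_univ, nsmul_eq_mul,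
            mul_one]
          rw [div_eq_div_iff hD0.ne' two_ne_zero, ← hD, mul_div_cancel₀ _ hδ.ne']
          ring
      _ ≤ δ := by linarith
  refine le_trans (sub_le_sub_left hbadsum 1)
    (one_sub_sum_le_sum_of_forall_not_imp_mem Pn hPn0 hPn1 _ bad _ fun s hs => ?_)
  refine mem_filter.2 ⟨mem_univ s, fun hAΦ => ?_⟩
  have hp y z : pZy s y z = q (A s) y z := hpZy s y z
  have hpeq y : pZy s y = q (A s) y := funext (hp y)
  have hdev y z (h : 0 < pZy s y z) : pY y * pZy s y z - phat (A s) s y z ≤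
      Real.sqrt (2 * (pY y * pZy s y z) * Real.log (D / pZy s y z) / n) := by
    rw [hp] at h ⊢
    by_contra hlt
    exact hs (A s, y, z) (mem_product.2 ⟨hAΦ, mem_univ _⟩)
      ((hbad_iff _ _).2 ⟨h, not_le.1 hlt⟩)
  have hsn : 0 < Real.sqrt n := Real.sqrt_pos.2 hn'
  have hε0 y : 0 ≤ εy s y := by
    rw [hεy]
    rcases Nat.eq_zero_or_pos m with hm | hm
    · simp [hm]
    · have hne : Nonempty (∀ i, E i) := by
        by_contra h
        rw [not_nonempty_iff] at h
        simpa using hW1 y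
      exact mul_nonneg ((abs_nonneg _).trans
        (hsens s y ⟨0, hm⟩ hne.some hne.some fun _ _ => rfl)) (Real.sqrt_nonneg _)
  have hH0 y : 0 ≤ HZy s y := by
    rw [hHZy, hpeq]
    exact entB_nonneg _ (hq0 _ y) (hq1 _ y)
  have hlog2 : 0 < Real.log 2 := Real.log_pos one_lt_two
  let K : 𝒴 → ℝ := fun y => (HZy s y + εy s y) * Real.log 2 + Real.log D
  have hKsum : ∑ y, pY y * K y = IXZY s * Real.log 2 + G₂ s * Real.log 2 + Real.log D := by
    have hI : IXZY s = ∑ y, pY y * HZy s y := by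
      rw [hIXZY]
      refine sum_congr rfl fun y _ => ?_
      rw [entB_graph, hHZy]
      ring
    rw [hI, hG₂, sum_mul, sum_mul, sum_mul, ← one_mul (Real.log D), ← hpY1, sum_mul,
      ← sum_add_distrib, ← sum_add_distrib]
    refine sum_congr rfl fun y _ => ?_
    simp only [K, hεy]
    ring
  have hR (x : 𝒳) (y : 𝒴) : ℓ (B s (A s x)) y ≤ ℛ s := by
    rw [hℛ]
    exact le_sup' (fun a : 𝒳 × 𝒴 => ℓ (B s (A s a.1)) a.2) (mem_univ (x, y))
  have hR0 : 0 ≤ ℛ s :=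
    (hℓ0 _ _).trans (hR (Classical.arbitrary 𝒳) (Classical.arbitrary 𝒴))
  have hL0 : 0 ≤ L s := hL s ▸ Real.iSup_nonneg fun i => hℓ0 _ _
  have hmemT y z : z ∈ Ztyp s y ↔
      0 < pZy s y z ∧ -Real.logb 2 (pZy s y z) - HZy s y ≤ εy s y := by
    rw [hZtyp]
    simp
  have hgap := sum_gap_le pY hpY0 hpY1 (pZy s) (phat (A s) s) (fun y z => ℓ (B s z) y)
    (fun y z => hp y z ▸ hq0 _ y z)
    (fun y z => mul_nonneg (by positivity) (sum_nonneg fun i _ => hb0 _ _ _ _))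
    (fun y z => hℓ0 _ _) (Ztyp s) K
    (fun y => add_nonneg (mul_nonneg (add_nonneg (hH0 y) (hε0 y)) hlog2.le) (Real.log_nonneg hD1))
    (ℛ s) (1 / (Real.sqrt n / γ)) (G₃ s) n hn' hR0
    (fun y z h => by
      rw [hpZy] at h
      obtain ⟨ξ, hξ, -⟩ := exists_ne_zero_of_sum_ne_zero h.ne'
      rw [← (mem_filter.1 hξ).2]
      exact hR _ y)
    (fun y => sum_atypical_le (ν y) (hν0 y) (hν1 y) (fun ξ => A s (χ y ξ)) (pZy s y)
      (fun z => by simp only [hpZy, hPΞ]) (hpos s y) (c s y) (hsens s y) _ (div_pos hsn hγ) _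
      (fun z => by rw [hmemT, hHZy, hεy]))
    (fun y z hz => by
      obtain ⟨h, htyp⟩ := (hmemT y z).1 hz
      refine (hdev y z h).trans (Real.sqrt_le_sqrt ?_)
      have hlog : Real.log (D / pZy s y z) ≤ K y := by
        have hlogb : Real.logb 2 (pZy s y z) * Real.log 2 = Real.log (pZy s y z) :=
          div_mul_cancel₀ _ hlog2.ne'
        rw [Real.log_div hD0.ne' h.ne', ← hlogb]
        simp only [K]
        nlinarith
      gcongr
      exact mul_nonneg zero_le_two (mul_nonneg (hpY0 y) h.le))
    (fun y => by
      rw [hG₃]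
      exact le_sup' (fun y => ∑ z ∈ Ztyp s y,
        ℓ (B s z) y * Real.sqrt (2 * (Fintype.card 𝒴) * pZy s y z)) (mem_univ y))
  have hΔeq : Δ s = ∑ y, ∑ z, ℓ (B s z) y * (pY y * pZy s y z - phat (A s) s y z) := by
    have hemp : (1 / n : ℝ) * ∑ i, ℓ (B s (A s (s i).1)) (s i).2 =
        ∑ y, ∑ z, ℓ (B s z) y * phat (A s) s y z := by
      calc _ = (1 / n : ℝ) * ∑ i, ∑ y, ∑ z,
            ℓ (B s z) y * b y z (A s (s i).1) (s i).2 := by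
            congr 1
            exact sum_congr rfl fun i _ => (hsumb (fun y z => ℓ (B s z) y) _ _).symm
        _ = _ := by
            rw [sum_comm, mul_sum]
            refine sum_congr rfl fun y _ => ?_
            rw [sum_comm, mul_sum]
            refine sum_congr rfl fun z _ => ?_
            rw [← mul_sum]
            ring
    rw [hΔ, hmean (A s) (fun z y => ℓ (B s z) y), hemp]
    simp only [hp, mul_sub, sum_sub_distrib]
  rw [hΔeq, ← hKsum]
  refine hgap.trans (add_le_add_right ?_ _)
  have hrem : 0 ≤ L s * Real.sqrt (2 * γ * (Fintype.card 𝒴)) *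
      Real.sqrt (Real.log Φ.card + Real.log (2 * (Fintype.card 𝒴) / δ)) /
        (n : ℝ) ^ ((1 : ℝ) / 4) := by positivity
  rw [hG₁, add_div, one_div_div, mul_div_assoc', mul_comm (ℛ s)]
  exact le_add_of_nonneg_left (by positivity)
end

section
/- For every λ > 0 and δ ∈ (0,1), setting ε = (1/λ)·log₂(C_λ/δ) and Φ_ε = {q ∈ M : −log₂ p(q) − H(A) ≤ ε}, one has both P(A ∉ Φ_ε) ≤ δ and |Φ_ε| ≤ 2^{H(A)+ε}. -/
open Real Finset
open scoped Classical

/-- for a random variable `A` with distribution `p` on a finite set `M`,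
base-2 entropy `H`, and `C_λ = 2^{−λH}·Σ_{p q>0} p q^{1−λ}`, taking
`ε = (1/λ)·log₂(C_λ/δ)` and `Φ_ε = {q : −log₂ p(q) − H ≤ ε}` (only `p q > 0` can
qualify, since `−log₂ 0 = +∞`), one has `P(A ∉ Φ_ε) ≤ δ` and `|Φ_ε| ≤ 2^{H+ε}`. -/
theorem typical_encoder_set {M : Type*} [Fintype M] (p : M → ℝ)
    (hp0 : ∀ q, 0 ≤ p q) (hp1 : ∑ q, p q = 1)
    (lam δ : ℝ) (hlam : 0 < lam) (hδ0 : 0 < δ) (hδ1 : δ < 1)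
    (H Clam ε : ℝ)
    (hH : H = -∑ q, if 0 < p q then p q * Real.logb 2 (p q) else 0)
    (hClam : Clam = 2 ^ (-(lam * H)) * ∑ q, if 0 < p q then p q ^ (1 - lam) else 0)
    (hε : ε = (1 / lam) * Real.logb 2 (Clam / δ)) :
    ∑ q ∈ Finset.univ.filter
        (fun q => ¬(0 < p q ∧ -Real.logb 2 (p q) - H ≤ ε)), p q ≤ δ ∧
      ((Finset.univ.filter
          (fun q : M => 0 < p q ∧ -Real.logb 2 (p q) - H ≤ ε)).card : ℝ) ≤ 2 ^ (H + ε) := by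
  obtain ⟨q₀, hq₀⟩ : ∃ q, 0 < p q := by
    by_contra! h
    have := Finset.sum_nonpos (s := Finset.univ) (fun q _ => h q)
    linarith
  have hterm : ∀ q, 0 ≤ if 0 < p q then p q ^ (1 - lam) else 0 := fun q => by
    split_ifs with h
    · exact (Real.rpow_pos_of_pos h _).le
    · exact le_rfl
  have hS : 0 < ∑ q, if 0 < p q then p q ^ (1 - lam) else 0 :=
    Finset.sum_pos' (fun q _ => hterm q)
      ⟨q₀, Finset.mem_univ _, by rw [if_pos hq₀]; exact Real.rpow_pos_of_pos hq₀ _⟩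
  have hC : 0 < Clam := hClam ▸ mul_pos (Real.rpow_pos_of_pos two_pos _) hS
  have hpow : (2 : ℝ) ^ (lam * ε) = Clam / δ := by
    have h : lam * ε = Real.logb 2 (Clam / δ) := by rw [hε]; field_simp
    rw [h, Real.rpow_logb two_pos (by norm_num) (div_pos hC hδ0)]
  have hlog : ∀ q, 0 < p q → (2 : ℝ) ^ Real.logb 2 (p q) = p q := fun q h =>
    Real.rpow_logb two_pos (by norm_num) h
  constructor
  · set K : ℝ := 2 ^ (-(lam * (H + ε))) with hK
    have hK0 : 0 < K := Real.rpow_pos_of_pos two_pos _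
    have hbound : ∀ q, ¬(0 < p q ∧ -Real.logb 2 (p q) - H ≤ ε) →
        p q ≤ (if 0 < p q then p q ^ (1 - lam) else 0) * K := by
      intro q hq
      by_cases h : 0 < p q
      · have hlt : Real.logb 2 (p q) ≤ -(H + ε) := by
          have : ¬(-Real.logb 2 (p q) - H ≤ ε) := fun h' => hq ⟨h, h'⟩
          linarith
        have hle : p q ^ lam ≤ K := by
          conv_lhs => rw [← hlog q h]
          rw [← Real.rpow_mul two_pos.le, hK]
          exact Real.rpow_le_rpow_of_exponent_le one_le_two (by nlinarith)
        rw [if_pos h]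
        calc p q = p q ^ (1 - lam) * p q ^ lam := by
              rw [← Real.rpow_add h, sub_add_cancel, Real.rpow_one]
          _ ≤ p q ^ (1 - lam) * K :=
              mul_le_mul_of_nonneg_left hle (Real.rpow_pos_of_pos h _).le
      · rw [if_neg h, zero_mul]
        exact not_lt.mp h
    calc _ ≤ ∑ q ∈ Finset.univ.filter (fun q => ¬(0 < p q ∧ -Real.logb 2 (p q) - H ≤ ε)),
            (if 0 < p q then p q ^ (1 - lam) else 0) * K :=
          Finset.sum_le_sum fun q hq => hbound q (Finset.mem_filter.mp hq).2
      _ ≤ ∑ q, (if 0 < p q then p q ^ (1 - lam) else 0) * K :=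
          Finset.sum_le_sum_of_subset_of_nonneg (Finset.filter_subset _ _)
            fun q _ _ => mul_nonneg (hterm q) hK0.le
      _ = Clam * ((2 : ℝ) ^ (lam * ε))⁻¹ := by
          have hKmul : K = 2 ^ (-(lam * H)) * ((2 : ℝ) ^ (lam * ε))⁻¹ := by
            rw [hK, ← Real.rpow_neg two_pos.le, ← Real.rpow_add two_pos]
            congr 1
            ring
          rw [← Finset.sum_mul, hKmul, hClam]
          ring
      _ = δ := by rw [hpow]; field_simp
  · set Φ := Finset.univ.filter (fun q : M => 0 < p q ∧ -Real.logb 2 (p q) - H ≤ ε)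
    have hmass : (Φ.card : ℝ) * 2 ^ (-(H + ε)) ≤ 1 := by
      calc (Φ.card : ℝ) * 2 ^ (-(H + ε)) = ∑ q ∈ Φ, (2 : ℝ) ^ (-(H + ε)) := by
            rw [Finset.sum_const, nsmul_eq_mul]
        _ ≤ ∑ q ∈ Φ, p q := by
            refine Finset.sum_le_sum fun q hq => ?_
            obtain ⟨h, hle⟩ := (Finset.mem_filter.mp hq).2
            rw [← hlog q h]
            exact Real.rpow_le_rpow_of_exponent_le one_le_two (by linarith)
        _ ≤ ∑ q, p q :=
            Finset.sum_le_sum_of_subset_of_nonneg (Finset.filter_subset _ _) fun q _ _ => hp0 q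
        _ = 1 := hp1
    rw [Real.rpow_neg two_pos.le, ← div_eq_mul_inv,
      div_le_one (Real.rpow_pos_of_pos two_pos _)] at hmass
    exact hmass
end

section
/- Let (p_1,…,p_N) be a probability vector with p_1 ≥ p_2 ≥ … ≥ p_N, and suppose p_i ≤ C/i^α for all i, where α > 1 and C ≥ 1. Then the entropy satisfies H(p) ≤ 1 + C·α·( ln(2)/2^α + ln(3)/3^α + 3^{1−α}·((α−1)·ln(3) + 1)/(α−1)² ). -/
open Real Finset

/-- Fenchel-Young inequality for `negMulLog` and the exponential. -/
theorem negMulLog_le_mul_add_exp_neg {p : ℝ} (hp : 0 ≤ p) (s : ℝ) :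
    negMulLog p ≤ p * (s - 1) + exp (-s) := by
  rcases hp.eq_or_lt with rfl | hp
  · simpa using (exp_pos (-s)).le
  · have h := add_one_le_exp (-s - log p)
    rw [exp_sub, exp_log hp, le_div_iff₀ hp] at h
    unfold negMulLog
    linarith

theorem negMulLog_le_half {p : ℝ} (hp : 0 ≤ p) : negMulLog p ≤ 1 / 2 := by
  have h := negMulLog_le_mul_add_exp_neg hp 1
  have h2 : exp (-1) ≤ 1 / 2 := by
    rw [exp_neg, inv_le_comm₀ (exp_pos 1) (by norm_num)]
    linarith [add_one_le_exp (1 : ℝ)]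
  linarith

theorem negMulLog_le_of_le_div_rpow {p x α C : ℝ} (hp : 0 ≤ p) (hC : 1 ≤ C) (hx : 0 < x)
    (hL : 1 ≤ α * log x) (h : p ≤ C / x ^ α) :
    negMulLog p ≤ C * α * (log x / x ^ α) := by
  have hexp : exp (-(α * log x)) = (x ^ α)⁻¹ := by
    rw [exp_neg, rpow_def_of_pos hx, mul_comm]
  have h1 := negMulLog_le_mul_add_exp_neg hp (α * log x)
  have h2 := mul_le_mul_of_nonneg_right h (sub_nonneg.2 hL)
  have h3 : (x ^ α)⁻¹ ≤ C * (x ^ α)⁻¹ := le_mul_of_one_le_left (by positivity) hC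
  rw [hexp] at h1
  calc negMulLog p ≤ C / x ^ α * (α * log x - 1) + C * (x ^ α)⁻¹ := by linarith
    _ = C * α * (log x / x ^ α) := by ring

/-- The value of `∫ t in Ioi x, log t / t ^ α` for `1 < α` and `0 < x`. -/
noncomputable def logDivRpowTail (α x : ℝ) : ℝ :=
  x ^ (1 - α) * ((α - 1) * log x + 1) / (α - 1) ^ 2

theorem logDivRpowTail_nonneg {α x : ℝ} (hα : 1 < α) (hx : 1 ≤ x) :
    0 ≤ logDivRpowTail α x := by
  have := log_nonneg hx
  have := sub_pos.2 hα
  unfold logDivRpowTail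
  positivity

theorem hasDerivAt_logDivRpowTail {α x : ℝ} (hα : 1 < α) (hx : 0 < x) :
    HasDerivAt (logDivRpowTail α) (-(log x / x ^ α)) x := by
  have hα' : α - 1 ≠ 0 := (sub_pos.2 hα).ne'
  have h := ((hasDerivAt_rpow_const (p := 1 - α) (Or.inl hx.ne')).mul
    (((hasDerivAt_log hx.ne').const_mul (α - 1)).add_const 1)).div_const ((α - 1) ^ 2)
  refine h.congr_deriv ?_
  have e1 : x ^ (1 - α - 1) = (x ^ α)⁻¹ := by
    rw [← rpow_neg hx.le]; congr 1; ring
  have e2 : x ^ (1 - α) = x * (x ^ α)⁻¹ := by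
    rw [rpow_sub hx, rpow_one, div_eq_mul_inv]
  have hxα : x ^ α ≠ 0 := (rpow_pos_of_pos hx α).ne'
  rw [e1, e2]
  field_simp
  ring

theorem exp_inv_le_three {α : ℝ} (hα : 1 < α) : exp α⁻¹ ≤ 3 := by
  have := inv_le_one_of_one_le₀ hα.le
  linarith [exp_le_exp.2 this, exp_one_lt_d9]

theorem log_div_rpow_le_logDivRpowTail_sub {α x : ℝ} (hα : 1 < α) (hx : 3 ≤ x) :
    log (x + 1) / (x + 1) ^ α ≤ logDivRpowTail α x - logDivRpowTail α (x + 1) := by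
  have hd : ∀ y ∈ Set.Icc x (x + 1),
      HasDerivAt (logDivRpowTail α) (-(log y / y ^ α)) y := fun y hy ↦
    hasDerivAt_logDivRpowTail hα (by linarith [hy.1])
  obtain ⟨c, hc, h⟩ := exists_hasDerivAt_eq_slope (logDivRpowTail α) _
    (by linarith : x < x + 1) (fun y hy ↦ (hd y hy).continuousAt.continuousWithinAt)
    (fun y hy ↦ hd y (Set.Ioo_subset_Icc_self hy))
  have h3 := exp_inv_le_three hα
  have hanti := log_div_self_rpow_antitoneOn (by linarith : 0 < α)
    (Set.mem_Ici.2 (h3.trans (by linarith [hc.1])))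
    (Set.mem_Ici.2 (h3.trans (by linarith))) hc.2.le
  rw [add_sub_cancel_left, div_one] at h
  simp only at hanti
  linarith

theorem sum_log_div_rpow_le {α : ℝ} (hα : 1 < α) (n : ℕ) :
    ∑ i ∈ Icc 1 n, log i / (i : ℝ) ^ α ≤
      log 2 / 2 ^ α + log 3 / 3 ^ α + logDivRpowTail α 3 := by
  have key : ∀ m : ℕ, ∑ i ∈ Icc 1 (m + 3), log i / (i : ℝ) ^ α ≤
      log 2 / 2 ^ α + log 3 / 3 ^ α + logDivRpowTail α 3 - logDivRpowTail α (m + 3) := by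
    intro m
    induction m with
    | zero => simp [sum_Icc_succ_top]
    | succ m ih =>
      have h := log_div_rpow_le_logDivRpowTail_sub hα
        (by linarith [Nat.cast_nonneg (α := ℝ) m] : (3 : ℝ) ≤ m + 3)
      rw [show m + 1 + 3 = m + 3 + 1 by ring, sum_Icc_succ_top (by lia)]
      push_cast
      rw [show (m : ℝ) + 1 + 3 = m + 3 + 1 by ring]
      linarith
  have hmono : ∑ i ∈ Icc 1 n, log i / (i : ℝ) ^ α ≤
      ∑ i ∈ Icc 1 (n + 3), log i / (i : ℝ) ^ α :=
    sum_le_sum_of_subset_of_nonneg (Icc_subset_Icc_right (by lia)) fun i _ _ ↦ by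
      have := log_natCast_nonneg i
      positivity
  have h := logDivRpowTail_nonneg hα
    (by linarith [Nat.cast_nonneg (α := ℝ) n] : (1 : ℝ) ≤ n + 3)
  linarith [key n]

/-- a nonincreasing probability vector with `p_i ≤ C/i^α` (`α > 1`, `C ≥ 1`)
has natural-log entropy at most
`1 + C·α·( ln2/2^α + ln3/3^α + 3^{1−α}((α−1)ln3 + 1)/(α−1)² )`. -/
theorem entropy_fast_decay_bound (N : ℕ) (p : ℕ → ℝ) (α C : ℝ)
    (hα : 1 < α) (hC : 1 ≤ C)
    (hp0 : ∀ i ∈ Finset.Icc 1 N, 0 ≤ p i)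
    (hp1 : ∑ i ∈ Finset.Icc 1 N, p i = 1)
    (hmono : ∀ i ∈ Finset.Icc 1 N, ∀ j ∈ Finset.Icc 1 N, i ≤ j → p j ≤ p i)
    (hdecay : ∀ i ∈ Finset.Icc 1 N, p i ≤ C / (i : ℝ) ^ α) :
    -∑ i ∈ Finset.Icc 1 N, p i * Real.log (p i) ≤
      1 + C * α * (Real.log 2 / 2 ^ α + Real.log 3 / 3 ^ α
        + 3 ^ (1 - α) * ((α - 1) * Real.log 3 + 1) / (α - 1) ^ 2) := by
  have hterm : ∀ i ∈ Icc 1 N, negMulLog (p i) ≤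
      (if i ≤ 2 then 1 / 2 else 0) + C * α * (log i / (i : ℝ) ^ α) := by
    intro i hi
    split_ifs with h
    · have := log_natCast_nonneg i
      have : 0 ≤ C * α * (log i / (i : ℝ) ^ α) := by positivity
      linarith [negMulLog_le_half (hp0 i hi)]
    · have hi3 : (3 : ℝ) ≤ i := by exact_mod_cast (by lia : 3 ≤ i)
      have hlog : 1 ≤ log i := by
        rw [le_log_iff_exp_le (by linarith)]
        linarith [exp_one_lt_d9]
      rw [zero_add]
      exact negMulLog_le_of_le_div_rpow (hp0 i hi) hC (by linarith) (by nlinarith) (hdecay i hi)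
  have hhalf : ∑ i ∈ Icc 1 N, (if i ≤ 2 then 1 / 2 else 0 : ℝ) ≤ 1 := by
    have hcard : #{i ∈ Icc 1 N | i ≤ 2} ≤ #(Icc 1 2) := card_le_card fun i hi ↦ by
      simp only [mem_filter, mem_Icc] at hi ⊢
      lia
    have hcard' : (#{i ∈ Icc 1 N | i ≤ 2} : ℝ) ≤ 2 := by exact_mod_cast hcard
    rw [← sum_filter, sum_const, nsmul_eq_mul]
    linarith
  calc -∑ i ∈ Icc 1 N, p i * log (p i) = ∑ i ∈ Icc 1 N, negMulLog (p i) := by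
        simp [negMulLog, sum_neg_distrib]
    _ ≤ _ := sum_le_sum hterm
    _ = ∑ i ∈ Icc 1 N, (if i ≤ 2 then 1 / 2 else 0 : ℝ)
          + C * α * ∑ i ∈ Icc 1 N, log i / (i : ℝ) ^ α := by
        rw [sum_add_distrib, mul_sum]
    _ ≤ _ := add_le_add hhalf
        (mul_le_mul_of_nonneg_left (sum_log_div_rpow_le hα N) (by positivity))
end

section
/- Let N ≥ 2, 0 ≤ α < 1, and let c_1,…,c_N satisfy 0 < c ≤ c_i ≤ C. Set Z = Σ_{i=1}^N c_i/i^α and p_i = c_i/(Z·i^α). Then the entropy H(p) = −Σ_{i=1}^N p_i·ln(p_i) satisfies ln(c/C) − ln(1−α) + ln(1 − N^{α−1}) − α·C·N^{1−α}/((1−α)²·Z) ≤ H(p) − ln(N) ≤ ln(C/c) − ln(1−α) + α·C·N^{1−α}/((1−α)²·Z). -/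
open Real Finset

/-- The concave function `x ↦ x ^ (1 - α)` lies below its tangents. -/
lemma rpow_one_sub_le_tangent {α x y : ℝ} (hα0 : 0 ≤ α) (hα1 : α < 1) (hx : 0 < x)
    (hy : 0 ≤ y) : y ^ (1 - α) ≤ x ^ (1 - α) + (1 - α) * (y - x) * (1 / x ^ α) := by
  have h1 : (1 + (y - x) / x) ^ (1 - α) ≤ 1 + (1 - α) * ((y - x) / x) := by
    apply rpow_one_add_le_one_add_mul_self _ (by linarith) (by linarith)
    rw [le_div_iff₀ hx]
    linarith
  have h2 : 1 + (y - x) / x = y / x := by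
    field_simp
    ring
  have hxa : 0 < x ^ α := rpow_pos_of_pos hx α
  have h3 : x ^ (1 - α) = x / x ^ α := by rw [rpow_sub hx, rpow_one]
  rw [h2, div_rpow hy hx.le, div_le_iff₀ (rpow_pos_of_pos hx _)] at h1
  refine h1.trans_eq ?_
  rw [h3]
  field_simp

lemma sum_one_div_rpow_le {α : ℝ} (hα0 : 0 ≤ α) (hα1 : α < 1) (n : ℕ) :
    ∑ i ∈ Finset.Icc 1 n, 1 / (i : ℝ) ^ α ≤ (n : ℝ) ^ (1 - α) / (1 - α) := by
  have hb : 0 < 1 - α := by linarith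
  induction n with
  | zero => simp [zero_rpow hb.ne']
  | succ n ih =>
    rw [Finset.sum_Icc_succ_top (by omega)]
    have h := rpow_one_sub_le_tangent (x := (n : ℝ) + 1) hα0 hα1 (by positivity)
      (Nat.cast_nonneg n)
    rw [le_div_iff₀ hb] at ih ⊢
    push_cast
    linarith

lemma le_sum_one_div_rpow {α : ℝ} (hα0 : 0 ≤ α) (hα1 : α < 1) {n : ℕ} (hn : 1 ≤ n) :
    ((n : ℝ) ^ (1 - α) - 1) / (1 - α) ≤ ∑ i ∈ Finset.Icc 1 n, 1 / (i : ℝ) ^ α := by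
  have hb : 0 < 1 - α := by linarith
  suffices h : (((n : ℝ) + 1) ^ (1 - α) - 1) / (1 - α) ≤
      ∑ i ∈ Finset.Icc 1 n, 1 / (i : ℝ) ^ α by
    refine le_trans ?_ h
    gcongr
    linarith
  clear hn
  induction n with
  | zero => simp
  | succ n ih =>
    rw [Finset.sum_Icc_succ_top (by omega)]
    have h := rpow_one_sub_le_tangent (x := (n : ℝ) + 1) (y := (n : ℝ) + 1 + 1) hα0 hα1
      (by positivity) (by positivity)
    rw [div_le_iff₀ hb] at ih ⊢
    push_cast
    linarith

lemma sum_one_div_rpow_mul_log_le {α : ℝ} (hα0 : 0 ≤ α) (hα1 : α < 1) {N n : ℕ}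
    (hn : 1 ≤ n) (hnN : n ≤ N) :
    ∑ i ∈ Finset.Icc 1 n, 1 / (i : ℝ) ^ α * (log N - log i) ≤
      (n : ℝ) ^ (1 - α) / (1 - α) * (log N - log n) + (n : ℝ) ^ (1 - α) / (1 - α) ^ 2 := by
  have hb : 0 < 1 - α := by linarith
  induction n, hn using Nat.le_induction with
  | base =>
    have hlog : 0 ≤ log (N : ℝ) := log_natCast_nonneg N
    have h1 : log (N : ℝ) ≤ 1 / (1 - α) * log N :=
      le_mul_of_one_le_left hlog (by rw [le_div_iff₀ hb]; linarith)
    have h2 : 0 ≤ 1 / (1 - α) ^ 2 := by positivity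
    simp only [Finset.Icc_self, Finset.sum_singleton, Nat.cast_one, one_rpow, log_one]
    linarith
  | succ n hn ih =>
    specialize ih (by omega)
    rw [Finset.sum_Icc_succ_top (by omega)]
    have hn0 : (0 : ℝ) < n := by exact_mod_cast hn
    have hn1 : (0 : ℝ) < (n : ℝ) + 1 := by positivity
    have hL : 0 ≤ log (N : ℝ) - log ((n : ℝ) + 1) := by
      have : log ((n : ℝ) + 1) ≤ log N := log_le_log hn1 (by exact_mod_cast hnN)
      linarith
    have h := rpow_one_sub_le_tangent hα0 hα1 hn1 hn0.le
    have hlog : (n : ℝ) ^ (1 - α) * ((1 - α) * (log ((n : ℝ) + 1) - log n)) ≤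
        ((n : ℝ) + 1) ^ (1 - α) - (n : ℝ) ^ (1 - α) := by
      have hp : 0 < (n : ℝ) ^ (1 - α) := rpow_pos_of_pos hn0 _
      have hq : 0 < ((n : ℝ) + 1) ^ (1 - α) := rpow_pos_of_pos hn1 _
      have h4 := log_le_sub_one_of_pos (div_pos hq hp)
      rw [log_div hq.ne' hp.ne', log_rpow hn1, log_rpow hn0] at h4
      have h5 := mul_le_mul_of_nonneg_left h4 hp.le
      have h6 : (n : ℝ) ^ (1 - α) * (((n : ℝ) + 1) ^ (1 - α) / (n : ℝ) ^ (1 - α) - 1) =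
          ((n : ℝ) + 1) ^ (1 - α) - (n : ℝ) ^ (1 - α) := by
        field_simp
      linarith
    push_cast
    generalize (n : ℝ) ^ (1 - α) = u at *
    generalize ((n : ℝ) + 1) ^ (1 - α) = v at *
    generalize 1 / ((n : ℝ) + 1) ^ α = w at *
    have h7 : w ≤ (v - u) / (1 - α) := by
      rw [le_div_iff₀ hb]
      linarith
    have h8 := mul_le_mul_of_nonneg_right h7 hL
    have h9 : u / (1 - α) * (log ((n : ℝ) + 1) - log n) ≤ (v - u) / (1 - α) ^ 2 := by
      rw [le_div_iff₀ (by positivity)]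
      refine le_trans (le_of_eq ?_) hlog
      field_simp
    have h10 : (v - u) / (1 - α) * (log (N : ℝ) - log ((n : ℝ) + 1)) =
      v / (1 - α) * (log (N : ℝ) - log ((n : ℝ) + 1)) -
        u / (1 - α) * (log (N : ℝ) - log n) +
          u / (1 - α) * (log ((n : ℝ) + 1) - log n) := by ring
    have h11 : (v - u) / (1 - α) ^ 2 = v / (1 - α) ^ 2 - u / (1 - α) ^ 2 := by ring
    linarith

/-- for `p_i = c_i/(Z·i^α)` with `Z = Σ_{i=1}^N c_i/i^α`, `0 ≤ α < 1`,
`0 < c ≤ c_i ≤ C` and `N ≥ 2`, the natural-log entropy `H(p)` satisfies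
`ln(c/C) − ln(1−α) + ln(1 − N^{α−1}) − α·C·N^{1−α}/((1−α)²·Z) ≤ H(p) − ln N
   ≤ ln(C/c) − ln(1−α) + α·C·N^{1−α}/((1−α)²·Z)`. -/
theorem entropy_slow_decay_bounds (N : ℕ) (hN : 2 ≤ N) (α : ℝ) (hα0 : 0 ≤ α) (hα1 : α < 1)
    (c C : ℝ) (cs : ℕ → ℝ) (hc : 0 < c)
    (hlow : ∀ i ∈ Finset.Icc 1 N, c ≤ cs i) (hhigh : ∀ i ∈ Finset.Icc 1 N, cs i ≤ C)
    (Z : ℝ) (hZ : Z = ∑ i ∈ Finset.Icc 1 N, cs i / (i : ℝ) ^ α)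
    (p : ℕ → ℝ) (hp : ∀ i ∈ Finset.Icc 1 N, p i = cs i / (Z * (i : ℝ) ^ α))
    (H : ℝ) (hH : H = -∑ i ∈ Finset.Icc 1 N, p i * Real.log (p i)) :
    Real.log (c / C) - Real.log (1 - α) + Real.log (1 - (N : ℝ) ^ (α - 1))
        - α * C * (N : ℝ) ^ (1 - α) / ((1 - α) ^ 2 * Z) ≤ H - Real.log N ∧
      H - Real.log N ≤ Real.log (C / c) - Real.log (1 - α)
        + α * C * (N : ℝ) ^ (1 - α) / ((1 - α) ^ 2 * Z) := by
  have hb : 0 < 1 - α := by linarith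
  have hN1 : 1 ≤ N := by omega
  have hN0 : (0 : ℝ) < N := by exact_mod_cast hN1
  have hC : 0 < C := by
    have h1 : 1 ∈ Finset.Icc 1 N := by simp [hN1]
    linarith [hlow 1 h1, hhigh 1 h1]
  have hpos : ∀ i ∈ Finset.Icc 1 N, (0 : ℝ) < i := fun i hi => by
    exact_mod_cast (Finset.mem_Icc.mp hi).1
  have hpow : ∀ i ∈ Finset.Icc 1 N, (0 : ℝ) < (i : ℝ) ^ α := fun i hi =>
    rpow_pos_of_pos (hpos i hi) α
  have hNb : 1 < (N : ℝ) ^ (1 - α) :=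
    one_lt_rpow (by exact_mod_cast (by omega : 1 < N)) hb
  set S := ∑ i ∈ Finset.Icc 1 N, 1 / (i : ℝ) ^ α with hS
  have hSle : S ≤ (N : ℝ) ^ (1 - α) / (1 - α) := sum_one_div_rpow_le hα0 hα1 N
  have hleS : ((N : ℝ) ^ (1 - α) - 1) / (1 - α) ≤ S := le_sum_one_div_rpow hα0 hα1 hN1
  have hS0 : 0 < S := lt_of_lt_of_le (div_pos (by linarith) hb) hleS
  have hZle : Z ≤ C * S := by
    rw [hZ, hS, Finset.mul_sum]
    refine Finset.sum_le_sum fun i hi => ?_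
    rw [mul_one_div]
    exact div_le_div_of_nonneg_right (hhigh i hi) (hpow i hi).le
  have hleZ : c * S ≤ Z := by
    rw [hZ, hS, Finset.mul_sum]
    refine Finset.sum_le_sum fun i hi => ?_
    rw [mul_one_div]
    exact div_le_div_of_nonneg_right (hlow i hi) (hpow i hi).le
  have hZ0 : 0 < Z := lt_of_lt_of_le (mul_pos hc hS0) hleZ
  have hp0 : ∀ i ∈ Finset.Icc 1 N, 0 < p i := fun i hi => by
    rw [hp i hi]
    exact div_pos (hc.trans_le (hlow i hi)) (mul_pos hZ0 (hpow i hi))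
  have hpsum : ∑ i ∈ Finset.Icc 1 N, p i = 1 := by
    have h : ∑ i ∈ Finset.Icc 1 N, p i = (∑ i ∈ Finset.Icc 1 N, cs i / (i : ℝ) ^ α) / Z := by
      rw [Finset.sum_div]
      refine Finset.sum_congr rfl fun i hi => ?_
      rw [hp i hi, div_div, mul_comm Z]
    rw [h, ← hZ, div_self hZ0.ne']
  have hHeq : H = log Z - ∑ i ∈ Finset.Icc 1 N, p i * log (cs i) +
      α * (log N - ∑ i ∈ Finset.Icc 1 N, p i * (log N - log i)) := by
    have h : ∀ i ∈ Finset.Icc 1 N, p i * log (p i) =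
        p i * log (cs i) - p i * log Z - α * (p i * log N - p i * (log N - log i)) := by
      intro i hi
      have hlog : log (p i) = log (cs i) - (log Z + α * log i) := by
        rw [hp i hi, log_div (hc.trans_le (hlow i hi)).ne' (mul_pos hZ0 (hpow i hi)).ne',
          log_mul hZ0.ne' (hpow i hi).ne', log_rpow (hpos i hi)]
      rw [hlog]
      ring
    rw [hH, Finset.sum_congr rfl h, Finset.sum_sub_distrib, Finset.sum_sub_distrib,
      ← Finset.mul_sum, Finset.sum_sub_distrib, ← Finset.sum_mul, ← Finset.sum_mul, hpsum]
    ring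
  have hcsge : log c ≤ ∑ i ∈ Finset.Icc 1 N, p i * log (cs i) := by
    rw [← one_mul (log c), ← hpsum, Finset.sum_mul]
    exact Finset.sum_le_sum fun i hi =>
      mul_le_mul_of_nonneg_left (log_le_log hc (hlow i hi)) (hp0 i hi).le
  have hcsle : ∑ i ∈ Finset.Icc 1 N, p i * log (cs i) ≤ log C := by
    rw [← one_mul (log C), ← hpsum, Finset.sum_mul]
    exact Finset.sum_le_sum fun i hi => mul_le_mul_of_nonneg_left
      (log_le_log (hc.trans_le (hlow i hi)) (hhigh i hi)) (hp0 i hi).le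
  have hloggap : ∀ i ∈ Finset.Icc 1 N, 0 ≤ log (N : ℝ) - log i := fun i hi =>
    sub_nonneg.mpr (log_le_log (hpos i hi) (by exact_mod_cast (Finset.mem_Icc.mp hi).2))
  have hgap0 : 0 ≤ α * ∑ i ∈ Finset.Icc 1 N, p i * (log N - log i) :=
    mul_nonneg hα0 (Finset.sum_nonneg fun i hi => mul_nonneg (hp0 i hi).le (hloggap i hi))
  have hgap : α * ∑ i ∈ Finset.Icc 1 N, p i * (log N - log i) ≤
      α * C * (N : ℝ) ^ (1 - α) / ((1 - α) ^ 2 * Z) := by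
    have h1 : ∑ i ∈ Finset.Icc 1 N, p i * (log N - log i) ≤
        C / Z * ∑ i ∈ Finset.Icc 1 N, 1 / (i : ℝ) ^ α * (log N - log i) := by
      rw [Finset.mul_sum]
      refine Finset.sum_le_sum fun i hi => ?_
      rw [← mul_assoc]
      refine mul_le_mul_of_nonneg_right ?_ (hloggap i hi)
      rw [hp i hi, div_mul_div_comm, mul_one]
      exact div_le_div_of_nonneg_right (hhigh i hi) (mul_pos hZ0 (hpow i hi)).le
    have h2 := sum_one_div_rpow_mul_log_le hα0 hα1 hN1 le_rfl
    rw [sub_self, mul_zero, zero_add] at h2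
    have h3 := h1.trans (mul_le_mul_of_nonneg_left h2 (div_pos hC hZ0).le)
    refine (mul_le_mul_of_nonneg_left h3 hα0).trans_eq ?_
    field_simp
  have hlogZle : log Z ≤ log C + ((1 - α) * log N - log (1 - α)) := by
    have h := log_le_log hZ0 (hZle.trans (mul_le_mul_of_nonneg_left hSle hC.le))
    rwa [log_mul hC.ne' (div_pos (by linarith) hb).ne', log_div (by linarith) hb.ne',
      log_rpow hN0] at h
  have hlelogZ : log c + ((1 - α) * log N + log (1 - (N : ℝ) ^ (α - 1)) - log (1 - α)) ≤
      log Z := by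
    have hlt : (N : ℝ) ^ (α - 1) < 1 :=
      rpow_lt_one_of_one_lt_of_neg (by exact_mod_cast (by omega : 1 < N)) (by linarith)
    have hfac : (N : ℝ) ^ (1 - α) - 1 = (N : ℝ) ^ (1 - α) * (1 - (N : ℝ) ^ (α - 1)) := by
      rw [mul_sub, ← rpow_add hN0]
      simp
    have hdiv : 0 < ((N : ℝ) ^ (1 - α) - 1) / (1 - α) := div_pos (by linarith) hb
    have h := log_le_log (mul_pos hc hdiv) ((mul_le_mul_of_nonneg_left hleS hc.le).trans hleZ)
    rwa [log_mul hc.ne' hdiv.ne', log_div (by linarith) hb.ne', hfac,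
      log_mul (by linarith) (by linarith), log_rpow hN0] at h
  rw [log_div hc.ne' hC.ne', log_div hC.ne' hc.ne', hHeq]
  constructor <;> linarith
end

section
/- Let N ≥ 1, 0 ≤ α < 1, and let c_1,…,c_N satisfy 0 < c ≤ c_i ≤ C. Set Z = Σ_{i=1}^N c_i/i^α and p_i = c_i/(Z·i^α). Then | Σ_{i=1}^N p_i·ln(i) − ln(N) | ≤ C·N^{1−α} / ((1−α)²·Z). -/
open Real Finset

theorem hasDerivAt_rpow_mul_log_sub (L : ℝ) {s x : ℝ} (hs : s ≠ 0) (hx : 0 < x) :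
    HasDerivAt (fun y : ℝ => y ^ s * ((L - Real.log y) / s + 1 / s ^ 2))
      (x ^ (s - 1) * (L - Real.log x)) x := by
  have h := (Real.hasDerivAt_rpow_const (p := s) (Or.inl hx.ne')).mul
    ((((Real.hasDerivAt_log hx.ne').const_sub L).div_const s).add_const (1 / s ^ 2))
  refine h.congr_deriv ?_
  have hxs : x ^ s = x ^ (s - 1) * x := by
    rw [← Real.rpow_add_one hx.ne', sub_add_cancel]
  rw [hxs]
  field_simp
  ring

/-- Partial sums of `i ^ (-α) * log (N / i)` are bounded by the corresponding integral. -/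
theorem sum_log_sub_div_rpow_le {N : ℕ} {α : ℝ} (hα0 : 0 ≤ α) (hα1 : α < 1)
    {M : ℕ} (hM : 1 ≤ M) (hMN : M ≤ N) :
    ∑ i ∈ Finset.Icc 1 M, (Real.log N - Real.log i) / (i : ℝ) ^ α ≤
      (M : ℝ) ^ (1 - α) * ((Real.log N - Real.log M) / (1 - α) + 1 / (1 - α) ^ 2) := by
  have hs : 0 < 1 - α := by linarith
  induction M, hM using Nat.le_induction with
  | base =>
    have hlog : 0 ≤ Real.log N := Real.log_natCast_nonneg N
    have hdiv : Real.log N ≤ Real.log N / (1 - α) := by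
      rw [le_div_iff₀ hs]
      nlinarith
    have : 0 ≤ 1 / (1 - α) ^ 2 := by positivity
    simp only [Finset.Icc_self, Finset.sum_singleton, Nat.cast_one, Real.log_one, Real.one_rpow,
      sub_zero, div_one, one_mul]
    linarith
  | succ M hM ih =>
    rw [Finset.sum_Icc_succ_top (by omega)]
    have hM0 : (0 : ℝ) < M := by exact_mod_cast hM
    have hder : ∀ x : ℝ, 0 < x → _ := fun x hx =>
      hasDerivAt_rpow_mul_log_sub (Real.log N) hs.ne' hx
    obtain ⟨ξ, ⟨hMξ, hξM⟩, hξ⟩ := exists_hasDerivAt_eq_slope _ _ (lt_add_one (M : ℝ))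
      (fun x hx => (hder x (hM0.trans_le hx.1)).continuousAt.continuousWithinAt)
      (fun x hx => hder x (hM0.trans hx.1))
    have hξ0 : 0 < ξ := hM0.trans hMξ
    have hN : (M : ℝ) + 1 ≤ N := by exact_mod_cast hMN
    have hmono : (Real.log N - Real.log ((M : ℝ) + 1)) / ((M : ℝ) + 1) ^ α ≤
        ξ ^ (1 - α - 1) * (Real.log N - Real.log ξ) := by
      rw [show 1 - α - 1 = -α by ring, Real.rpow_neg hξ0.le, ← div_eq_inv_mul]
      have hlogN : Real.log ((M : ℝ) + 1) ≤ Real.log N := Real.log_le_log (by positivity) hN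
      have hlogξ : Real.log ξ ≤ Real.log ((M : ℝ) + 1) := Real.log_le_log hξ0 hξM.le
      exact div_le_div₀ (by linarith) (by linarith) (Real.rpow_pos_of_pos hξ0 α)
        (Real.rpow_le_rpow hξ0.le hξM.le hα0)
    rw [add_sub_cancel_left, div_one] at hξ
    have := ih (by omega)
    push_cast
    linarith

/-- for `p_i = c_i/(Z·i^α)` with `Z = Σ_{i=1}^N c_i/i^α`, `0 ≤ α < 1`,
`0 < c ≤ c_i ≤ C` and `N ≥ 1`, one has `|Σ_{i=1}^N p_i·ln(i) − ln N| ≤ C·N^{1−α}/((1−α)²·Z)`. -/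
theorem weighted_log_sum_close_to_logN (N : ℕ) (hN : 1 ≤ N) (α : ℝ) (hα0 : 0 ≤ α) (hα1 : α < 1)
    (c C : ℝ) (cs : ℕ → ℝ) (hc : 0 < c)
    (hlow : ∀ i ∈ Finset.Icc 1 N, c ≤ cs i) (hhigh : ∀ i ∈ Finset.Icc 1 N, cs i ≤ C)
    (Z : ℝ) (hZ : Z = ∑ i ∈ Finset.Icc 1 N, cs i / (i : ℝ) ^ α)
    (p : ℕ → ℝ) (hp : ∀ i ∈ Finset.Icc 1 N, p i = cs i / (Z * (i : ℝ) ^ α)) :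
    |(∑ i ∈ Finset.Icc 1 N, p i * Real.log i) - Real.log N| ≤
      C * (N : ℝ) ^ (1 - α) / ((1 - α) ^ 2 * Z) := by
  have hpos : ∀ i ∈ Finset.Icc 1 N, (0 : ℝ) < (i : ℝ) ^ α := fun i hi =>
    Real.rpow_pos_of_pos (by exact_mod_cast (Finset.mem_Icc.mp hi).1) α
  have hZ0 : 0 < Z := by
    rw [hZ]
    exact Finset.sum_pos (fun i hi => div_pos (hc.trans_le (hlow i hi)) (hpos i hi))
      ⟨1, Finset.mem_Icc.mpr ⟨le_rfl, hN⟩⟩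
  have hlog : ∀ i ∈ Finset.Icc 1 N, 0 ≤ Real.log N - Real.log i := fun i hi => by
    have hi' := Finset.mem_Icc.mp hi
    exact sub_nonneg.mpr (Real.log_le_log (by exact_mod_cast hi'.1) (by exact_mod_cast hi'.2))
  have hC : 0 < C := hc.trans_le
    ((hlow 1 (Finset.mem_Icc.mpr ⟨le_rfl, hN⟩)).trans (hhigh 1 (Finset.mem_Icc.mpr ⟨le_rfl, hN⟩)))
  have hdiff : (∑ i ∈ Finset.Icc 1 N, p i * Real.log i) - Real.log N =
      -((∑ i ∈ Finset.Icc 1 N, cs i * ((Real.log N - Real.log i) / (i : ℝ) ^ α)) / Z) := by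
    have hsum : ∑ i ∈ Finset.Icc 1 N, cs i * ((Real.log N - Real.log i) / (i : ℝ) ^ α) =
        Z * Real.log N - Z * ∑ i ∈ Finset.Icc 1 N, p i * Real.log i := by
      rw [Finset.mul_sum]
      nth_rw 1 [hZ]
      rw [Finset.sum_mul, ← Finset.sum_sub_distrib]
      refine Finset.sum_congr rfl fun i hi => ?_
      have := (hpos i hi).ne'
      rw [hp i hi]
      field_simp
    rw [hsum]
    field_simp
    ring
  have hnonneg : 0 ≤ ∑ i ∈ Finset.Icc 1 N, cs i * ((Real.log N - Real.log i) / (i : ℝ) ^ α) :=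
    Finset.sum_nonneg fun i hi =>
      mul_nonneg (hc.le.trans (hlow i hi)) (div_nonneg (hlog i hi) (hpos i hi).le)
  have hbound : ∑ i ∈ Finset.Icc 1 N, cs i * ((Real.log N - Real.log i) / (i : ℝ) ^ α) ≤
      C * ((N : ℝ) ^ (1 - α) / (1 - α) ^ 2) := by
    calc
      _ ≤ C * ∑ i ∈ Finset.Icc 1 N, (Real.log N - Real.log i) / (i : ℝ) ^ α := by
        rw [Finset.mul_sum]
        exact Finset.sum_le_sum fun i hi =>
          mul_le_mul_of_nonneg_right (hhigh i hi) (div_nonneg (hlog i hi) (hpos i hi).le)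
      _ ≤ _ := by
        refine mul_le_mul_of_nonneg_left ?_ hC.le
        refine (sum_log_sub_div_rpow_le hα0 hα1 hN le_rfl).trans_eq ?_
        rw [sub_self, zero_div, zero_add, mul_one_div]
  rw [hdiff, abs_neg, abs_of_nonneg (div_nonneg hnonneg hZ0.le), ← div_div, mul_div_assoc]
  exact div_le_div_of_nonneg_right hbound hZ0.le
end
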